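/- If Q(G) is Archimedean and the Slater condition holds for the LSIPP problem (P), then p^sos = p*, where p^sos = inf{ c^T x : x ∈ ℝ^m, a(Y)^T x + b(Y) ∈ Q(G) }. -/

import Mathlib

open MvPolynomial

/-- A polynomial is a sum of squares. -/
def SOSPoly {n : ℕ} (p : MvPolynomial (Fin n) ℝ) : Prop :=
  ∃ (t : ℕ) (q : Fin t → MvPolynomial (Fin n) ℝ), p = ∑ i, q i ^ 2

/-- Membership in the quadratic module Q(G) generated by `g`. -/
def QModMem {n s : ℕ} (g : Fin s → MvPolynomial (Fin n) ℝ)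
    (p : MvPolynomial (Fin n) ℝ) : Prop :=
  ∃ (σ₀ : MvPolynomial (Fin n) ℝ) (σ : Fin s → MvPolynomial (Fin n) ℝ),
    SOSPoly σ₀ ∧ (∀ j, SOSPoly (σ j)) ∧ p = σ₀ + ∑ j, σ j * g j

/-- The basic semialgebraic index set S. -/
def indexSet {n s : ℕ} (g : Fin s → MvPolynomial (Fin n) ℝ) : Set (Fin n → ℝ) :=
  {y | ∀ j, 0 ≤ eval y (g j)}

/-- Feasibility for the LSIPP problem (P): a(y)ᵀx + b(y) ≥ 0 for all y ∈ S. -/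
def isFeasible {n m s : ℕ} (a : Fin m → MvPolynomial (Fin n) ℝ)
    (b : MvPolynomial (Fin n) ℝ) (g : Fin s → MvPolynomial (Fin n) ℝ)
    (x : Fin m → ℝ) : Prop :=
  ∀ y ∈ indexSet g, 0 ≤ (∑ i, x i * eval y (a i)) + eval y b

/-- The quadratic module Q(G) is Archimedean. -/
def QMArchimedean {n s : ℕ} (g : Fin s → MvPolynomial (Fin n) ℝ) : Prop :=
  ∃ ψ : MvPolynomial (Fin n) ℝ, QModMem g ψ ∧
    IsCompact {y : Fin n → ℝ | 0 ≤ eval y ψ}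

/-- A sum of squares is nonnegative at every point. -/
theorem SOSPoly.eval_nonneg {n : ℕ} {p : MvPolynomial (Fin n) ℝ} (hp : SOSPoly p)
    (y : Fin n → ℝ) : 0 ≤ eval y p := by
  obtain ⟨t, q, rfl⟩ := hp
  simp only [map_sum, map_pow]
  positivity

/-- Elements of the quadratic module are nonnegative on the index set. -/
theorem QModMem.eval_nonneg {n s : ℕ} {g : Fin s → MvPolynomial (Fin n) ℝ}
    {p : MvPolynomial (Fin n) ℝ} (hp : QModMem g p) {y : Fin n → ℝ} (hy : y ∈ indexSet g) :
    0 ≤ eval y p := by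
  obtain ⟨σ₀, σ, h₀, h, rfl⟩ := hp
  simp only [map_add, map_sum, map_mul]
  exact add_nonneg (h₀.eval_nonneg y)
    (Finset.sum_nonneg fun j _ => mul_nonneg ((h j).eval_nonneg y) (hy j))

/-- If `w ≤ (1 - t) * u + t * v` for all `t ∈ (0, 1]`, then `w ≤ u`. -/
theorem le_of_forall_le_segment {u v w : ℝ}
    (h : ∀ t : ℝ, 0 < t → t ≤ 1 → w ≤ (1 - t) * u + t * v) : w ≤ u := by
  have hcont : Continuous fun t : ℝ => (1 - t) * u + t * v := by fun_prop
  have hlim := (hcont.tendsto 0).mono_left (nhdsWithin_le_nhds (s := Set.Ioi 0))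
  simp only [sub_zero, one_mul, zero_mul, add_zero] at hlim
  refine ge_of_tendsto hlim ?_
  filter_upwards [Ioc_mem_nhdsGT (zero_lt_one' ℝ)] with t ht
  exact h t ht.1 ht.2

/-- if Q(G) is Archimedean and the Slater condition holds for (P),
then p^sos = p*, i.e. p* is the infimum of c ᵀ x over x with a(Y)ᵀx + b(Y) ∈ Q(G).
(Putinar's Positivstellensatz is assumed, as permitted.) -/
theorem stmt1 {n m s : ℕ} (c : Fin m → ℝ) (a : Fin m → MvPolynomial (Fin n) ℝ)
    (b : MvPolynomial (Fin n) ℝ) (g : Fin s → MvPolynomial (Fin n) ℝ)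
    (pstar : ℝ)
    (hfeas : ∃ x, isFeasible a b g x)
    (hglb : IsGLB {v : ℝ | ∃ x, isFeasible a b g x ∧ v = ∑ i, c i * x i} pstar)
    (harch : QMArchimedean g)
    (hslater : ∃ x : Fin m → ℝ, ∀ y ∈ indexSet g,
      0 < (∑ i, x i * eval y (a i)) + eval y b)
    (hputinar : ∀ p : MvPolynomial (Fin n) ℝ,
      (∀ y ∈ indexSet g, 0 < eval y p) → QModMem g p) :
    IsGLB {v : ℝ | ∃ x : Fin m → ℝ,
      QModMem g ((∑ i, C (x i) * a i) + b) ∧ v = ∑ i, c i * x i} pstar := by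
  have heval (x : Fin m → ℝ) (y : Fin n → ℝ) :
      eval y ((∑ i, C (x i) * a i) + b) = (∑ i, x i * eval y (a i)) + eval y b := by
    simp
  constructor
  · rintro v ⟨x, hx, rfl⟩
    exact hglb.1 ⟨x, fun y hy => heval x y ▸ hx.eval_nonneg hy, rfl⟩
  · intro w hw
    refine hglb.2 ?_
    rintro v ⟨x, hx, rfl⟩
    obtain ⟨z, hz⟩ := hslater
    have hcomb (t : ℝ) (d : Fin m → ℝ) :
        ∑ i, ((1 - t) * x i + t * z i) * d i =
          (1 - t) * ∑ i, x i * d i + t * ∑ i, z i * d i := by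
      simp only [Finset.mul_sum, ← Finset.sum_add_distrib]
      exact Finset.sum_congr rfl fun i _ => by ring
    refine le_of_forall_le_segment (v := ∑ i, c i * z i) fun t ht ht1 => ?_
    refine hw ⟨fun i => (1 - t) * x i + t * z i, hputinar _ fun y hy => ?_, ?_⟩
    · rw [heval, hcomb]
      have hxy := mul_nonneg (sub_nonneg.2 ht1) (hx y hy)
      have hzy := mul_pos ht (hz y hy)
      linarith
    · simpa only [mul_comm (c _)] using (hcomb t c).symm
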